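/- Let S ≥ 1 and for each ν ∈ {0,…,S−1} let H[ν] ∈ ℂ^{M×K} have rank K; let σ² > 0 and κ ∈ (0,1). For P > 0 define f(P) as the supremum, over all families {D[ν]}_{ν=0}^{S−1} of K×K diagonal matrices with nonnegative diagonal entries satisfying Σ_{ν=0}^{S−1} tr(D[ν]) ≤ P, of (1/S) Σ_{ν=0}^{S−1} [log₂ det(I_M + (1/σ²)·H[ν] D[ν] H[ν]^H) − log₂ det(I_M + ((1−κ)/σ²)·H[ν] D[ν] H[ν]^H)]. Then lim_{P→∞} f(P) = K · log₂(1/(1−κ)). -/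

import Mathlib

open scoped ComplexOrder
open Matrix

/-- For Hermitian `A`, `det (1 + c A)` is the product of `1 + c λ` over the eigenvalues of `A`. -/
theorem Matrix.IsHermitian.det_one_add_smul {n : Type*} [Fintype n] [DecidableEq n]
    {A : Matrix n n ℂ} (hA : A.IsHermitian) (c : ℝ) :
    (1 + (c : ℂ) • A).det = ((∏ i, (1 + c * hA.eigenvalues i) : ℝ) : ℂ) := by
  have hU : star (hA.eigenvectorUnitary : Matrix n n ℂ) * (hA.eigenvectorUnitary : Matrix n n ℂ) = 1 :=
    Unitary.coe_star_mul_self _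
  conv_lhs => rw [hA.spectral_theorem, Unitary.conjStarAlgAut_apply, ← Matrix.smul_mul,
    Matrix.det_one_add_mul_comm, Matrix.mul_smul, ← mul_assoc, hU, one_mul]
  rw [← Matrix.diagonal_one, ← Matrix.diagonal_smul, Matrix.diagonal_add, Matrix.det_diagonal]
  simp

/-- `log₂ det (1 + c X Xᴴ)` in terms of the eigenvalues of the Gram matrix `Xᴴ X`. -/
theorem logb_det_one_add_smul_mul_conjTranspose {m n : Type*} [Fintype m] [DecidableEq m]
    [Fintype n] [DecidableEq n] (X : Matrix m n ℂ) {c : ℝ} (hc : 0 ≤ c) :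
    Real.logb 2 (1 + (c : ℂ) • (X * Xᴴ)).det.re =
      ∑ i, Real.logb 2 (1 + c * (isHermitian_conjTranspose_mul_self X).eigenvalues i) := by
  rw [← Matrix.smul_mul, Matrix.det_one_add_mul_comm, Matrix.mul_smul,
    (isHermitian_conjTranspose_mul_self X).det_one_add_smul, Complex.ofReal_re,
    Real.logb_prod]
  intro i _
  have := (posSemidef_conjTranspose_mul_self X).eigenvalues_nonneg i
  positivity

theorem mul_diagonal_mul_conjTranspose_eq {m n : Type*} [Fintype n] [DecidableEq n]
    (H : Matrix m n ℂ) {d : n → ℝ} (hd : ∀ i, 0 ≤ d i) :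
    H * Matrix.diagonal (fun i => (d i : ℂ)) * Hᴴ =
      (H * Matrix.diagonal (fun i => (√(d i) : ℂ))) *
        (H * Matrix.diagonal (fun i => (√(d i) : ℂ)))ᴴ := by
  rw [Matrix.conjTranspose_mul, Matrix.diagonal_conjTranspose, Matrix.mul_assoc, Matrix.mul_assoc,
    ← Matrix.mul_assoc (Matrix.diagonal _) (Matrix.diagonal _), Matrix.diagonal_mul_diagonal]
  congr 3
  ext i
  simp only [Pi.star_apply, RCLike.star_def, Complex.conj_ofReal]
  rw [← Complex.ofReal_mul, Real.mul_self_sqrt (hd i)]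

theorem smul_mul_diagonal_const_mul_conjTranspose {m n : Type*} [Fintype n] [DecidableEq n]
    (H : Matrix m n ℂ) (c d : ℝ) :
    (c : ℂ) • (H * Matrix.diagonal (fun _ : n => (d : ℂ)) * Hᴴ) = ((c * d : ℝ) : ℂ) • (H * Hᴴ) := by
  rw [← Matrix.smul_one_eq_diagonal, Matrix.mul_smul, Matrix.mul_one, Matrix.smul_mul,
    smul_smul, Complex.ofReal_mul]

theorem logb_one_add_sub_logb_one_add_le {t a b : ℝ} (ht : 0 ≤ t) (hb : 0 < b) (hab : b ≤ a) :
    Real.logb 2 (1 + a * t) - Real.logb 2 (1 + b * t) ≤ Real.logb 2 (a / b) := by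
  have ha : 0 < a := hb.trans_le hab
  rw [← Real.logb_div (by positivity) (by positivity)]
  apply Real.logb_le_logb_of_le one_lt_two (by positivity)
  rw [div_le_div_iff₀ (by positivity) hb]
  nlinarith

theorem tendsto_logb_one_add_sub_logb_one_add {a b : ℝ} (ha : 0 < a) (hb : 0 < b) :
    Filter.Tendsto (fun t : ℝ => Real.logb 2 (1 + a * t) - Real.logb 2 (1 + b * t))
      Filter.atTop (nhds (Real.logb 2 (a / b))) := by
  have h : ∀ c : ℝ, Filter.Tendsto (fun t : ℝ => t⁻¹ + c) Filter.atTop (nhds c) := fun c => by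
    simpa using tendsto_inv_atTop_zero.add_const c
  have h2 := ((h a).div (h b) hb.ne').log (by positivity)
  have h3 := h2.div_const (Real.log 2)
  refine Filter.Tendsto.congr' ?_ h3
  filter_upwards [Filter.eventually_gt_atTop 0] with t ht
  rw [← Real.logb_div (by positivity) (by positivity), Real.logb]
  simp only [Pi.div_apply]
  congr 2
  field_simp

theorem eigenvalues_conjTranspose_mul_self_pos {m : Type*} [Fintype m] {K : ℕ}
    {H : Matrix m (Fin K) ℂ} (hH : H.rank = K) (i : Fin K) :
    0 < (isHermitian_conjTranspose_mul_self H).eigenvalues i := by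
  refine lt_of_le_of_ne ((posSemidef_conjTranspose_mul_self H).eigenvalues_nonneg i) fun h => ?_
  have h1 := (isHermitian_conjTranspose_mul_self H).rank_eq_card_non_zero_eigs
  rw [Matrix.rank_conjTranspose_mul_self, hH] at h1
  have h2 := Fintype.card_subtype_lt
    (p := fun i => (isHermitian_conjTranspose_mul_self H).eigenvalues i ≠ 0) (x := i)
    (by simpa using h.symm)
  rw [← h1, Fintype.card_fin] at h2
  exact lt_irrefl _ h2

/-- Corollary 2 (high-SNR limit of the downlink DPC sum rate): with `S ≥ 1`
subcarriers, full-column-rank channels `H ν ∈ ℂ^{M×K}`, `σ² > 0` and `κ ∈ (0,1)`,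
the optimized sum rate
`f(P) = sup { (1/S) Σ_ν [log₂ det(I + (1/σ²)·H ν D ν (H ν)ᴴ)
              − log₂ det(I + ((1−κ)/σ²)·H ν D ν (H ν)ᴴ)] :
              D ν diagonal ≥ 0, Σ_ν tr(D ν) ≤ P }`
satisfies `f(P) → K·log₂(1/(1−κ))` as `P → ∞`. -/
theorem stmt_17 (S M K : ℕ) (hS : 1 ≤ S) (H : Fin S → Matrix (Fin M) (Fin K) ℂ)
    (hH : ∀ ν, (H ν).rank = K) (σ2 κ : ℝ) (hσ : 0 < σ2) (hκ : κ ∈ Set.Ioo (0:ℝ) 1) :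
    Filter.Tendsto
      (fun P : ℝ =>
        sSup { r : ℝ | ∃ D : Fin S → Fin K → ℝ,
          (∀ ν i, 0 ≤ D ν i) ∧ (∑ ν : Fin S, ∑ i : Fin K, D ν i) ≤ P ∧
          r = (1 / S : ℝ) * ∑ ν : Fin S,
            (Real.logb 2
                ((1 + ((1 / σ2 : ℝ) : ℂ) •
                  (H ν * Matrix.diagonal (fun i => (D ν i : ℂ)) * (H ν)ᴴ)).det.re) -
              Real.logb 2
                ((1 + (((1 - κ) / σ2 : ℝ) : ℂ) •
                  (H ν * Matrix.diagonal (fun i => (D ν i : ℂ)) * (H ν)ᴴ)).det.re)) })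
      Filter.atTop (nhds (K * Real.logb 2 (1 / (1 - κ)))) := by
  obtain ⟨hκ0, hκ1⟩ := hκ
  have hS0 : (0 : ℝ) < S := by exact_mod_cast hS
  have hb : 0 < (1 - κ) / σ2 := div_pos (by linarith) hσ
  have ha : 0 < 1 / σ2 := by positivity
  have hab : (1 - κ) / σ2 ≤ 1 / σ2 := by gcongr; linarith
  have hratio : 1 / σ2 / ((1 - κ) / σ2) = 1 / (1 - κ) := by
    field_simp
  have hupper : ∀ D : Fin S → Fin K → ℝ, (∀ ν i, 0 ≤ D ν i) →
      (1 / S : ℝ) * ∑ ν : Fin S,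
            (Real.logb 2
                ((1 + ((1 / σ2 : ℝ) : ℂ) •
                  (H ν * Matrix.diagonal (fun i => (D ν i : ℂ)) * (H ν)ᴴ)).det.re) -
              Real.logb 2
                ((1 + (((1 - κ) / σ2 : ℝ) : ℂ) •
                  (H ν * Matrix.diagonal (fun i => (D ν i : ℂ)) * (H ν)ᴴ)).det.re)) ≤
        K * Real.logb 2 (1 / (1 - κ)) := by
    intro D hD
    rw [one_div_mul_eq_div, div_le_iff₀' hS0]
    refine (Finset.sum_le_card_nsmul _ _ (K * Real.logb 2 (1 / (1 - κ))) fun ν _ => ?_).trans_eq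
      (by simp)
    rw [mul_diagonal_mul_conjTranspose_eq _ (hD ν),
      logb_det_one_add_smul_mul_conjTranspose _ ha.le,
      logb_det_one_add_smul_mul_conjTranspose _ hb.le, ← Finset.sum_sub_distrib, ← hratio]
    refine (Finset.sum_le_card_nsmul _ _ (Real.logb 2 (1 / σ2 / ((1 - κ) / σ2)))
      fun i _ => ?_).trans_eq (by simp)
    exact logb_one_add_sub_logb_one_add_le
      ((posSemidef_conjTranspose_mul_self _).eigenvalues_nonneg i) hb hab
  have hlower : Filter.Tendsto (fun P : ℝ => (1 / S : ℝ) * ∑ ν : Fin S, ∑ i : Fin K,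
      (Real.logb 2 (1 + 1 / σ2 *
          (P / (S * K) * (isHermitian_conjTranspose_mul_self (H ν)).eigenvalues i)) -
        Real.logb 2 (1 + (1 - κ) / σ2 *
          (P / (S * K) * (isHermitian_conjTranspose_mul_self (H ν)).eigenvalues i))))
      Filter.atTop (nhds (K * Real.logb 2 (1 / (1 - κ)))) := by
    have hlim : (K * Real.logb 2 (1 / (1 - κ)) : ℝ) =
        (1 / S : ℝ) * ∑ _ν : Fin S, ∑ _i : Fin K, Real.logb 2 (1 / (1 - κ)) := by
      simp [hS0.ne']
    rw [hlim, ← hratio]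
    refine (tendsto_finsetSum _ fun ν _ => tendsto_finsetSum _ fun i _ => ?_).const_mul _
    have hK : (0 : ℝ) < K := by exact_mod_cast i.pos
    exact (tendsto_logb_one_add_sub_logb_one_add ha hb).comp
      ((Filter.tendsto_id.atTop_div_const (by positivity)).atTop_mul_const
        (eigenvalues_conjTranspose_mul_self_pos (hH ν) i))
  refine tendsto_of_tendsto_of_tendsto_of_le_of_le' hlower tendsto_const_nhds ?_ ?_
  · filter_upwards [Filter.eventually_ge_atTop 0] with P hP
    have hd : 0 ≤ P / (S * K) := by positivity
    refine le_csSup ⟨K * Real.logb 2 (1 / (1 - κ)), ?_⟩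
      ⟨fun _ _ => P / (S * K), fun _ _ => hd, ?_, ?_⟩
    · rintro r ⟨D, hD, -, rfl⟩
      exact hupper D hD
    · simp only [Finset.sum_const, Finset.card_univ, Fintype.card_fin, nsmul_eq_mul]
      rcases Nat.eq_zero_or_pos K with rfl | hK
      · simpa using hP
      · have : (0 : ℝ) < K := by exact_mod_cast hK
        exact le_of_eq (by field_simp)
    · congr 1
      refine Finset.sum_congr rfl fun ν _ => ?_
      rw [smul_mul_diagonal_const_mul_conjTranspose, smul_mul_diagonal_const_mul_conjTranspose,
        logb_det_one_add_smul_mul_conjTranspose _ (by positivity),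
        logb_det_one_add_smul_mul_conjTranspose _ (by positivity), ← Finset.sum_sub_distrib]
      simp only [mul_assoc]
  · filter_upwards [Filter.eventually_ge_atTop 0] with P hP
    refine csSup_le ⟨_, fun _ _ => 0, fun _ _ => le_rfl, by simpa using hP, rfl⟩ ?_
    rintro r ⟨D, hD, -, rfl⟩
    exact hupper D hD
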